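/- Let α1, α2 ∈ K and let n be a natural number. For every element p of the free associative algebra K⟨X_1,…,X_n⟩, if the image of p under every K-algebra homomorphism from K⟨X_1,…,X_n⟩ to M_2(K) × M_2(K) × M_2(K) is zero, then the image of p under every K-algebra homomorphism from K⟨X_1,…,X_n⟩ to D_3(α1,α2) is zero; i.e., every polynomial identity of M_2(K)³ is a polynomial identity of D_3(α1,α2). -/

import Mathlib

noncomputable section

open FreeAlgebra

/-- The defining relations of the PBW deformation `D₃(α₁, α₂)` of the Fomin–Kirillov
algebra `E₃`: with generators `a = ι K 0`, `b = ι K 1`, `c = ι K 2`, the relations are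
`a² = b² = c² = α₁`, `ca + bc + ab = α₂` and `cb + ba + ac = α₂`. -/
inductive D3Rel (K : Type) [Field K] (α1 α2 : K) :
    FreeAlgebra K (Fin 3) → FreeAlgebra K (Fin 3) → Prop
  | ra : D3Rel K α1 α2 (ι K (0 : Fin 3) * ι K (0 : Fin 3))
      (algebraMap K (FreeAlgebra K (Fin 3)) α1)
  | rb : D3Rel K α1 α2 (ι K (1 : Fin 3) * ι K (1 : Fin 3))
      (algebraMap K (FreeAlgebra K (Fin 3)) α1)
  | rc : D3Rel K α1 α2 (ι K (2 : Fin 3) * ι K (2 : Fin 3))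
      (algebraMap K (FreeAlgebra K (Fin 3)) α1)
  | r1 : D3Rel K α1 α2
      (ι K (2 : Fin 3) * ι K (0 : Fin 3) + ι K (1 : Fin 3) * ι K (2 : Fin 3) +
        ι K (0 : Fin 3) * ι K (1 : Fin 3))
      (algebraMap K (FreeAlgebra K (Fin 3)) α2)
  | r2 : D3Rel K α1 α2
      (ι K (2 : Fin 3) * ι K (1 : Fin 3) + ι K (1 : Fin 3) * ι K (0 : Fin 3) +
        ι K (0 : Fin 3) * ι K (2 : Fin 3))
      (algebraMap K (FreeAlgebra K (Fin 3)) α2)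

/-- The algebra `D₃(α₁, α₂)`: the quotient of the free algebra `K⟨a,b,c⟩` by the two-sided
ideal generated by the relations above. -/
abbrev D3 (K : Type) [Field K] (α1 α2 : K) : Type := RingQuot (D3Rel K α1 α2)

/-- The generator `a` of `D₃(α₁, α₂)`. -/
def D3a (K : Type) [Field K] (α1 α2 : K) : D3 K α1 α2 :=
  RingQuot.mkAlgHom K (D3Rel K α1 α2) (ι K (0 : Fin 3))

/-- The generator `b` of `D₃(α₁, α₂)`. -/
def D3b (K : Type) [Field K] (α1 α2 : K) : D3 K α1 α2 :=
  RingQuot.mkAlgHom K (D3Rel K α1 α2) (ι K (1 : Fin 3))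

/-- The generator `c` of `D₃(α₁, α₂)`. -/
def D3c (K : Type) [Field K] (α1 α2 : K) : D3 K α1 α2 :=
  RingQuot.mkAlgHom K (D3Rel K α1 α2) (ι K (2 : Fin 3))

section NormalForm

variable {R E : Type*} [CommRing R] [Ring E] [Algebra R E]

/-- The `R`-linear combination of `1, a, b, ab, ba, aba` with coefficients `x`. -/
def wordSum (a b : E) (x : Fin 6 → R) : E :=
  x 0 • (1 : E) + x 1 • a + x 2 • b + x 3 • (a * b) + x 4 • (b * a) + x 5 • (a * b * a)

lemma wordSum_add (a b : E) (x y : Fin 6 → R) :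
    wordSum a b (x + y) = wordSum a b x + wordSum a b y := by
  simp only [wordSum, Pi.add_apply, add_smul]
  abel

lemma wordSum_smul (a b : E) (r : R) (x : Fin 6 → R) :
    wordSum a b (r • x) = r • wordSum a b x := by
  simp only [wordSum, Pi.smul_apply, smul_add, smul_smul, smul_eq_mul]

lemma wordSum_zero (a b : E) : wordSum a b (0 : Fin 6 → R) = 0 := by
  simp [wordSum]

/-- Elements `a, b, c` of an `R`-algebra satisfying the relations of `D₃(s, t)`. -/
structure D3Triple (s t : R) (a b c : E) : Prop where
  aa : a * a = s • 1
  bb : b * b = s • 1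
  cc : c * c = s • 1
  sum₁ : c * a + b * c + a * b = t • 1
  sum₂ : c * b + b * a + a * c = t • 1

namespace D3Triple

variable {s t : R} {a b c : E} (h : D3Triple s t a b c)
include h

lemma c_mul_a : c * a = t • 1 - b * c - a * b := by
  rw [← h.sum₁]; abel

lemma c_mul_b : c * b = t • 1 - b * a - a * c := by
  rw [← h.sum₂]; abel

lemma bab : b * a * b = a * b * a - t • a + t • b := by
  have h1 : c * a * a = s • c := by rw [mul_assoc, h.aa]; simp
  have h2 : c * a * a = t • a - t • b + s • c + b * a * b - a * b * a := by
    have h3 : b * c * a = t • b - s • c - b * a * b := by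
      rw [mul_assoc, h.c_mul_a, mul_sub, mul_sub, ← mul_assoc, ← mul_assoc, h.bb]; simp
    rw [h.c_mul_a, sub_mul, sub_mul, h3]
    simp only [smul_mul_assoc, one_mul]
    abel
  rw [h1] at h2
  rw [← sub_eq_zero] at h2 ⊢
  rw [← neg_eq_zero, ← h2]
  abel

lemma wordSum_mul_a (x : Fin 6 → R) :
    wordSum a b x * a = wordSum a b ![s * x 1, x 0, s * x 4, s * x 5, x 2, x 3] := by
  have h1 : b * a * a = s • b := by rw [mul_assoc, h.aa]; simp
  have h2 : a * b * a * a = s • (a * b) := by rw [mul_assoc, h.aa]; simp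
  simp only [wordSum, add_mul, smul_mul_assoc, one_mul, h1, h2, h.aa]
  simp [smul_smul, mul_comm s]
  abel

lemma wordSum_mul_b (x : Fin 6 → R) :
    wordSum a b x * b = wordSum a b ![s * x 2 - s * t * x 5, s * x 3 - t * x 4, x 0 + t * x 4,
      x 1 + t * x 5, s * x 5, x 4] := by
  have h1 : a * b * b = s • a := by rw [mul_assoc, h.bb]; simp
  have h2 : a * b * a * b = s • (b * a) - (s * t) • 1 + t • (a * b) := by
    rw [mul_assoc, mul_assoc, ← mul_assoc b, h.bab, mul_add, mul_sub, ← mul_assoc, ← mul_assoc,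
      h.aa]
    simp [h.aa, smul_smul, mul_comm]
  simp only [wordSum, add_mul, smul_mul_assoc, one_mul, h1, h2, h.bb, h.bab]
  simp [smul_smul, mul_comm, sub_smul, add_smul, smul_sub, smul_add]
  abel

/-- The set of combinations of the twelve words `w, w c` is stable under right multiplication
by `a`. -/
lemma exists_mul_a (x y : Fin 6 → R) : ∃ x' y' : Fin 6 → R,
    (wordSum a b x + wordSum a b y * c) * a = wordSum a b x' + wordSum a b y' * c := by
  obtain ⟨u, hu⟩ : ∃ u : Fin 6 → R, wordSum a b x * a = wordSum a b u := ⟨_, h.wordSum_mul_a x⟩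
  obtain ⟨v, hv⟩ : ∃ v : Fin 6 → R, wordSum a b y * b = wordSum a b v := ⟨_, h.wordSum_mul_b y⟩
  obtain ⟨w, hw⟩ : ∃ w : Fin 6 → R, wordSum a b y * a * b = wordSum a b w := by
    rw [h.wordSum_mul_a, h.wordSum_mul_b]; exact ⟨_, rfl⟩
  refine ⟨u + t • y + (-1 : R) • w, (-1 : R) • v, ?_⟩
  simp only [wordSum_add, wordSum_smul, ← hu, ← hv, ← hw, add_mul, mul_assoc _ c,
    h.c_mul_a, mul_sub]
  simp [mul_assoc]
  abel

/-- The set of combinations of the twelve words `w, w c` is stable under right multiplication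
by `b`. -/
lemma exists_mul_b (x y : Fin 6 → R) : ∃ x' y' : Fin 6 → R,
    (wordSum a b x + wordSum a b y * c) * b = wordSum a b x' + wordSum a b y' * c := by
  obtain ⟨u, hu⟩ : ∃ u : Fin 6 → R, wordSum a b x * b = wordSum a b u := ⟨_, h.wordSum_mul_b x⟩
  obtain ⟨v, hv⟩ : ∃ v : Fin 6 → R, wordSum a b y * a = wordSum a b v := ⟨_, h.wordSum_mul_a y⟩
  obtain ⟨w, hw⟩ : ∃ w : Fin 6 → R, wordSum a b y * b * a = wordSum a b w := by
    rw [h.wordSum_mul_b, h.wordSum_mul_a]; exact ⟨_, rfl⟩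
  refine ⟨u + t • y + (-1 : R) • w, (-1 : R) • v, ?_⟩
  simp only [wordSum_add, wordSum_smul, ← hu, ← hv, ← hw, add_mul, mul_assoc _ c,
    h.c_mul_b, mul_sub]
  simp [mul_assoc]
  abel

/-- The set of combinations of the twelve words `w, w c` is stable under right multiplication
by `c`. -/
lemma exists_mul_c (x y : Fin 6 → R) : ∃ x' y' : Fin 6 → R,
    (wordSum a b x + wordSum a b y * c) * c = wordSum a b x' + wordSum a b y' * c := by
  refine ⟨s • y, x, ?_⟩
  rw [add_mul, mul_assoc, h.cc, wordSum_smul]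
  simp [add_comm]

/-- Every noncommutative polynomial in `a, b, c` is an `R`-combination of the twelve words
`w, w c` with `w ∈ {1, a, b, ab, ba, aba}`. -/
lemma exists_normalForm {K : Type*} [Field K] [Algebra K R] [Algebra K E] [IsScalarTower K R E]
    (q : FreeAlgebra K (Fin 3)) : ∃ x y : Fin 6 → R,
    FreeAlgebra.lift K ![a, b, c] q = wordSum a b x + wordSum a b y * c := by
  suffices H : ∀ x y : Fin 6 → R, ∃ x' y' : Fin 6 → R,
      (wordSum a b x + wordSum a b y * c) * FreeAlgebra.lift K ![a, b, c] q =
        wordSum a b x' + wordSum a b y' * c by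
    simpa [wordSum] using H ![1, 0, 0, 0, 0, 0] 0
  induction q using FreeAlgebra.induction with
  | grade0 r =>
    intro x y
    refine ⟨algebraMap K R r • x, algebraMap K R r • y, ?_⟩
    rw [AlgHom.commutes, IsScalarTower.algebraMap_apply K R E, ← Algebra.commutes,
      ← Algebra.smul_def, wordSum_smul, wordSum_smul, smul_add, smul_mul_assoc]
  | grade1 i =>
    intro x y
    rw [FreeAlgebra.lift_ι_apply]
    fin_cases i
    · exact h.exists_mul_a x y
    · exact h.exists_mul_b x y
    · exact h.exists_mul_c x y
  | mul p q hp hq =>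
    intro x y
    obtain ⟨x₁, y₁, h₁⟩ := hp x y
    rw [map_mul, ← mul_assoc, h₁]
    exact hq x₁ y₁
  | add p q hp hq =>
    intro x y
    obtain ⟨x₁, y₁, h₁⟩ := hp x y
    obtain ⟨x₂, y₂, h₂⟩ := hq x y
    refine ⟨x₁ + x₂, y₁ + y₂, ?_⟩
    rw [map_add, mul_add, h₁, h₂, wordSum_add, wordSum_add, add_mul]
    abel

end D3Triple

end NormalForm

section GenericRepresentation

open Polynomial

variable {K : Type} [Field K]

/-- A square root `A` of `s` in `M₂(K[X])`. -/
def genA (s : K) : Matrix (Fin 2) (Fin 2) K[X] := !![0, 1; C s, 0]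

/-- A square root `B` of `s` in `M₂(K[X])` with `(A - B)² = X²`, where `A = genA s`. -/
def genB (s : K) : Matrix (Fin 2) (Fin 2) K[X] := !![X, 1; C s - X ^ 2, -X]

lemma genA_mul_genA (s : K) : genA s * genA s = (C s : K[X]) • 1 := by
  ext i j
  fin_cases i <;> fin_cases j <;> simp [genA, Matrix.mul_apply, Fin.sum_univ_two]

lemma genB_mul_genB (s : K) : genB s * genB s = (C s : K[X]) • 1 := by
  ext1 i j
  fin_cases i <;> fin_cases j <;> simp [genB, Matrix.mul_apply, Fin.sum_univ_two] <;> ring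

lemma genB_mul_genA (s : K) :
    genB s * genA s = (2 * C s - X ^ 2 : K[X]) • 1 - genA s * genB s := by
  ext1 i j
  fin_cases i <;> fin_cases j <;>
    simp [genA, genB, Matrix.mul_apply, Fin.sum_univ_two] <;> ring

/-- The matrices `1, A, B, AB` are linearly independent over `K[X]`. -/
lemma gen_linearIndependent (s : K) {x y z w : K[X]}
    (h : x • 1 + y • genA s + z • genB s + w • (genA s * genB s) = 0) :
    x = 0 ∧ y = 0 ∧ z = 0 ∧ w = 0 := by
  have h00 := congrFun (congrFun h 0) 0
  have h01 := congrFun (congrFun h 0) 1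
  have h10 := congrFun (congrFun h 1) 0
  have h11 := congrFun (congrFun h 1) 1
  simp [genA, genB] at h00 h01 h10 h11
  have hX : (X : K[X]) ≠ 0 := X_ne_zero
  have hd : (C (4 * s) - X ^ 2 : K[X]) ≠ 0 := by
    intro h0
    have := congrArg (fun q : K[X] => q.coeff 2) h0
    simp at this
  have h1 : X * z = C (2 * s) * w := by
    apply mul_left_cancel₀ hX
    simp only [map_mul, map_ofNat]
    linear_combination C s * h01 - h10
  have hw : w = 0 := by
    apply (mul_eq_zero.mp (_ : (C (4 * s) - X ^ 2) * w = 0)).resolve_left hd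
    simp only [map_mul, map_ofNat] at h1 ⊢
    linear_combination h00 - h11 - 2 * h1
  subst hw
  have hz : z = 0 := by simpa using h1
  subst hz
  simp_all

lemma genB_mul_genA_add_genA_mul_genB (s : K) :
    genB s * genA s + genA s * genB s = (2 * C s - X ^ 2 : K[X]) • 1 := by
  rw [genB_mul_genA, sub_add_cancel]

lemma smul_one_add_smul_one_eq (s : K) :
    (C s : K[X]) • 1 + (2 * C s - X ^ 2 : K[X]) • 1 =
      (C (3 * s) - X ^ 2 : K[X]) • (1 : Matrix (Fin 2) (Fin 2) K[X]) := by
  rw [← add_smul, map_mul, map_ofNat]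
  ring_nf

lemma d3Triple_genA_genA_genB (s : K) :
    D3Triple (C s : K[X]) (C (3 * s) - X ^ 2) (genA s) (genA s) (genB s) where
  aa := genA_mul_genA s
  bb := genA_mul_genA s
  cc := genB_mul_genB s
  sum₁ := by
    rw [← smul_one_add_smul_one_eq, ← genB_mul_genA_add_genA_mul_genB, ← genA_mul_genA]; abel
  sum₂ := by
    rw [← smul_one_add_smul_one_eq, ← genB_mul_genA_add_genA_mul_genB, ← genA_mul_genA]; abel

lemma d3Triple_genA_genB_genA (s : K) :
    D3Triple (C s : K[X]) (C (3 * s) - X ^ 2) (genA s) (genB s) (genA s) where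
  aa := genA_mul_genA s
  bb := genB_mul_genB s
  cc := genA_mul_genA s
  sum₁ := by
    rw [← smul_one_add_smul_one_eq, ← genB_mul_genA_add_genA_mul_genB, ← genA_mul_genA]; abel
  sum₂ := by
    rw [← smul_one_add_smul_one_eq, ← genB_mul_genA_add_genA_mul_genB, ← genA_mul_genA]; abel

lemma d3Triple_genB_genA_genA (s : K) :
    D3Triple (C s : K[X]) (C (3 * s) - X ^ 2) (genB s) (genA s) (genA s) where
  aa := genB_mul_genB s
  bb := genA_mul_genA s
  cc := genA_mul_genA s
  sum₁ := by
    rw [← smul_one_add_smul_one_eq, ← genB_mul_genA_add_genA_mul_genB, ← genA_mul_genA]; abel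
  sum₂ := by
    rw [← smul_one_add_smul_one_eq, ← genB_mul_genA_add_genA_mul_genB, ← genA_mul_genA]; abel

/-- The linear system expressing that a combination of the twelve words vanishes at the triples
`(A, A, B)`, `(A, B, A)`, `(B, A, A)`, where `A² = B² = s` and `AB + BA = u`, has only the trivial
solution. -/
lemma eq_zero_of_linear_system {R : Type*} [CommRing R] [IsDomain R] {s u : R}
    (hu : 2 * s - u ≠ 0) {x y : Fin 6 → R}
    (a₁ : x 0 + s * (x 3 + x 4) = 0) (b₁ : x 1 + x 2 + s * x 5 = 0)
    (c₁ : y 0 + s * (y 3 + y 4) = 0) (d₁ : y 1 + y 2 + s * y 5 = 0)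
    (a₂ : x 0 + u * x 4 + s * y 1 + u * y 2 = 0) (b₂ : x 1 + y 0 + u * (x 5 + y 3) = 0)
    (c₂ : x 2 - s * (x 5 + y 3) + s * y 4 = 0) (d₂ : x 3 - x 4 - y 2 + s * y 5 = 0)
    (a₃ : x 0 + u * (x 3 + y 1) + s * y 2 + (u ^ 2 - s ^ 2) * y 5 = 0)
    (b₃ : x 2 - s * x 5 + y 0 + u * y 4 = 0) (c₃ : x 1 + u * x 5 + s * (y 3 - y 4) = 0)
    (d₃ : x 4 - x 3 - y 1 - u * y 5 = 0) : x = 0 ∧ y = 0 := by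
  have cancel {q : R} (hq : (2 * s - u) * q = 0) : q = 0 := (mul_eq_zero.mp hq).resolve_left hu
  have hy5 : y 5 = 0 := cancel (by linear_combination d₁ + d₂ + d₃)
  have hy2 : y 2 = -y 1 := by linear_combination d₁ - s * hy5
  have hx4 : x 4 = x 3 + y 1 := by linear_combination -d₂ - hy2 + s * hy5
  have hx3 : x 3 = 0 := cancel (by
    linear_combination a₁ - a₂ + u * hy2 + (u - s) * hx4)
  have hy1 : y 1 = 0 := cancel (by
    linear_combination a₁ - a₃ + s * hy2 - s * hx4 - (2 * s - u) * hx3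
      + (u ^ 2 - s ^ 2) * hy5)
  have hx0 : x 0 = 0 := by linear_combination a₁ - s * hx4 - 2 * s * hx3 - s * hy1
  have hx5 : x 5 = 0 := cancel (by linear_combination b₁ - c₂ - c₃)
  have hy3 : y 3 = 0 := cancel (by linear_combination b₁ + c₁ - b₂ - c₂ - (2 * s - u) * hx5)
  have hy4 : y 4 = 0 := cancel (by linear_combination c₁ + c₂ - b₃)
  have hx2 : x 2 = 0 := by linear_combination c₂ + s * (hx5 + hy3) - s * hy4
  have hx1 : x 1 = 0 := by linear_combination b₁ - hx2 - s * hx5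
  have hy0 : y 0 = 0 := by linear_combination c₁ - s * (hy3 + hy4)
  rw [hy1, neg_zero] at hy2
  rw [hx3, hy1, add_zero] at hx4
  constructor <;> ext1 i <;> fin_cases i <;> assumption

/-- A combination of the twelve words which vanishes at the three triples `(A, A, B)`,
`(A, B, A)`, `(B, A, A)` has zero coefficients. -/
lemma eq_zero_of_wordSum_gen_eq_zero (s : K) {x y : Fin 6 → K[X]}
    (h₁ : wordSum (genA s) (genA s) x + wordSum (genA s) (genA s) y * genB s = 0)
    (h₂ : wordSum (genA s) (genB s) x + wordSum (genA s) (genB s) y * genA s = 0)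
    (h₃ : wordSum (genB s) (genA s) x + wordSum (genB s) (genA s) y * genA s = 0) :
    x = 0 ∧ y = 0 := by
  obtain ⟨a₁, b₁, c₁, d₁⟩ := gen_linearIndependent s
    (x := x 0 + C s * (x 3 + x 4)) (y := x 1 + x 2 + C s * x 5)
    (z := y 0 + C s * (y 3 + y 4)) (w := y 1 + y 2 + C s * y 5) <| by
      rw [← h₁]
      ext1 i j
      fin_cases i <;> fin_cases j <;>
        simp [wordSum, genA, genB, Matrix.mul_apply, Fin.sum_univ_two] <;> ring
  obtain ⟨a₂, b₂, c₂, d₂⟩ := gen_linearIndependent s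
    (x := x 0 + (2 * C s - X ^ 2) * x 4 + C s * y 1 + (2 * C s - X ^ 2) * y 2)
    (y := x 1 + y 0 + (2 * C s - X ^ 2) * (x 5 + y 3))
    (z := x 2 - C s * (x 5 + y 3) + C s * y 4)
    (w := x 3 - x 4 - y 2 + C s * y 5) <| by
      rw [← h₂]
      ext1 i j
      fin_cases i <;> fin_cases j <;>
        simp [wordSum, genA, genB, Matrix.mul_apply, Fin.sum_univ_two] <;> ring
  obtain ⟨a₃, b₃, c₃, d₃⟩ := gen_linearIndependent s
    (x := x 0 + (2 * C s - X ^ 2) * (x 3 + y 1) + C s * y 2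
      + ((2 * C s - X ^ 2) ^ 2 - C s ^ 2) * y 5)
    (y := x 2 - C s * x 5 + y 0 + (2 * C s - X ^ 2) * y 4)
    (z := x 1 + (2 * C s - X ^ 2) * x 5 + C s * (y 3 - y 4))
    (w := x 4 - x 3 - y 1 - (2 * C s - X ^ 2) * y 5) <| by
      rw [← h₃]
      ext1 i j
      fin_cases i <;> fin_cases j <;>
        simp [wordSum, genA, genB, Matrix.mul_apply, Fin.sum_univ_two] <;> ring
  refine eq_zero_of_linear_system (s := C s) (u := 2 * C s - X ^ 2) ?_
    a₁ b₁ c₁ d₁ a₂ b₂ c₂ d₂ a₃ b₃ c₃ d₃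
  simp

end GenericRepresentation

/-- A polynomial identity of `M₂(K)³` over an infinite field `K` is an identity of `M₂(K[X])`. -/
lemma map_eq_zero_of_identity {K : Type} [Field K] [Infinite K] {n : ℕ}
    {p : FreeAlgebra K (Fin n)}
    (hp : ∀ f : FreeAlgebra K (Fin n) →ₐ[K]
        (Matrix (Fin 2) (Fin 2) K × Matrix (Fin 2) (Fin 2) K × Matrix (Fin 2) (Fin 2) K),
      f p = 0)
    (f : FreeAlgebra K (Fin n) →ₐ[K] Matrix (Fin 2) (Fin 2) (Polynomial K)) : f p = 0 := by
  ext1 i j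
  refine Polynomial.funext fun x => ?_
  have h : ((Polynomial.aeval x).mapMatrix.comp f) p = 0 :=
    congrArg Prod.fst (hp (((Polynomial.aeval x).mapMatrix.comp f).prod
      (((Polynomial.aeval x).mapMatrix.comp f).prod ((Polynomial.aeval x).mapMatrix.comp f))))
  simpa [Polynomial.coe_aeval_eq_eval] using congrFun (congrFun h i) j

lemma d3Triple_D3 (K : Type) [Field K] (α1 α2 : K) :
    D3Triple α1 α2 (D3a K α1 α2) (D3b K α1 α2) (D3c K α1 α2) where
  aa := by
    simpa [D3a, Algebra.algebraMap_eq_smul_one] using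
      RingQuot.mkAlgHom_rel K (D3Rel.ra (K := K) (α1 := α1) (α2 := α2))
  bb := by
    simpa [D3b, Algebra.algebraMap_eq_smul_one] using
      RingQuot.mkAlgHom_rel K (D3Rel.rb (K := K) (α1 := α1) (α2 := α2))
  cc := by
    simpa [D3c, Algebra.algebraMap_eq_smul_one] using
      RingQuot.mkAlgHom_rel K (D3Rel.rc (K := K) (α1 := α1) (α2 := α2))
  sum₁ := by
    simpa [D3a, D3b, D3c, Algebra.algebraMap_eq_smul_one] using
      RingQuot.mkAlgHom_rel K (D3Rel.r1 (K := K) (α1 := α1) (α2 := α2))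
  sum₂ := by
    simpa [D3a, D3b, D3c, Algebra.algebraMap_eq_smul_one] using
      RingQuot.mkAlgHom_rel K (D3Rel.r2 (K := K) (α1 := α1) (α2 := α2))

lemma D3Triple.prod {R E F : Type*} [CommRing R] [Ring E] [Ring F] [Algebra R E] [Algebra R F]
    {s t : R} {a b c : E} {a' b' c' : F} (h : D3Triple s t a b c) (h' : D3Triple s t a' b' c') :
    D3Triple s t (a, a') (b, b') (c, c') where
  aa := Prod.ext h.aa h'.aa
  bb := Prod.ext h.bb h'.bb
  cc := Prod.ext h.cc h'.cc
  sum₁ := Prod.ext h.sum₁ h'.sum₁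
  sum₂ := Prod.ext h.sum₂ h'.sum₂

lemma map_wordSum {R E F : Type*} [CommRing R] [Ring E] [Ring F] [Algebra R E] [Algebra R F]
    (f : E →ₐ[R] F) (a b : E) (x : Fin 6 → R) :
    f (wordSum a b x) = wordSum (f a) (f b) x := by
  simp [wordSum]

/-- A noncommutative polynomial in three variables which vanishes at the three generic triples
of `2 × 2` matrices vanishes in `D₃(α₁, α₂)`. -/
lemma mkAlgHom_eq_zero {K : Type} [Field K] {α1 α2 δ : K} (hδ : δ ^ 2 = 3 * α1 - α2)
    {q : FreeAlgebra K (Fin 3)}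
    (hq : ∀ f : FreeAlgebra K (Fin 3) →ₐ[K] Matrix (Fin 2) (Fin 2) (Polynomial K), f q = 0) :
    RingQuot.mkAlgHom K (D3Rel K α1 α2) q = 0 := by
  let φ : Polynomial K →+* D3 K α1 α2 :=
    (algebraMap K (D3 K α1 α2)).comp (Polynomial.evalRingHom δ)
  let _ : Algebra (Polynomial K) (D3 K α1 α2) := φ.toAlgebra' fun r d =>
    Algebra.commutes (r.eval δ) d
  have hsmul (r : Polynomial K) (d : D3 K α1 α2) : r • d = r.eval δ • d := by
    rw [Algebra.smul_def, Algebra.smul_def]; rfl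
  have : IsScalarTower K (Polynomial K) (D3 K α1 α2) :=
    IsScalarTower.of_algebraMap_eq fun r =>
      (congrArg (algebraMap K (D3 K α1 α2)) (Polynomial.eval_C (a := r) (x := δ))).symm
  have h0 : D3Triple (Polynomial.C α1) (Polynomial.C (3 * α1) - Polynomial.X ^ 2)
      (D3a K α1 α2) (D3b K α1 α2) (D3c K α1 α2) := by
    have h := d3Triple_D3 K α1 α2
    have h2 : 3 * α1 - δ ^ 2 = α2 := by rw [hδ]; ring
    constructor <;> rw [hsmul]
    · simpa using h.aa
    · simpa using h.bb
    · simpa using h.cc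
    · simpa [h2] using h.sum₁
    · simpa [h2] using h.sum₂
  have H := (d3Triple_genA_genA_genB α1).prod
    ((d3Triple_genA_genB_genA α1).prod ((d3Triple_genB_genA_genA α1).prod h0))
  obtain ⟨x, y, hxy⟩ := H.exists_normalForm q
  let M := Matrix (Fin 2) (Fin 2) (Polynomial K)
  let S := Polynomial K
  obtain ⟨rfl, rfl⟩ : x = 0 ∧ y = 0 := by
    refine eq_zero_of_wordSum_gen_eq_zero α1 ?_ ?_ ?_
    · have h := congrArg (AlgHom.fst S M (M × M × D3 K α1 α2)) hxy
      rw [map_add, map_mul, map_wordSum, map_wordSum] at h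
      exact h.symm.trans (hq ((AlgHom.fst K M (M × M × D3 K α1 α2)).comp (lift K _)))
    · let f := (AlgHom.fst S M (M × D3 K α1 α2)).comp (AlgHom.snd S M (M × M × D3 K α1 α2))
      have h := congrArg f hxy
      rw [map_add, map_mul, map_wordSum, map_wordSum] at h
      exact h.symm.trans (hq ((f.restrictScalars K).comp (lift K _)))
    · let f := ((AlgHom.fst S M (D3 K α1 α2)).comp (AlgHom.snd S M (M × D3 K α1 α2))).comp
        (AlgHom.snd S M (M × M × D3 K α1 α2))
      have h := congrArg f hxy
      rw [map_add, map_mul, map_wordSum, map_wordSum] at h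
      exact h.symm.trans (hq ((f.restrictScalars K).comp (lift K _)))
  rw [wordSum_zero, zero_mul, add_zero] at hxy
  let f := ((AlgHom.snd K M (D3 K α1 α2)).comp (AlgHom.snd K M (M × D3 K α1 α2))).comp
    (AlgHom.snd K M (M × M × D3 K α1 α2))
  have hf : RingQuot.mkAlgHom K (D3Rel K α1 α2) =
      f.comp (lift K ![(genA α1, genA α1, genB α1, D3a K α1 α2),
        (genA α1, genB α1, genA α1, D3b K α1 α2), (genB α1, genA α1, genA α1, D3c K α1 α2)]) := by
    refine FreeAlgebra.hom_ext (funext fun i => ?_)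
    simp only [Function.comp_apply, AlgHom.comp_apply, FreeAlgebra.lift_ι_apply]
    fin_cases i <;> rfl
  rw [hf, AlgHom.comp_apply, hxy, map_zero]

theorem D3_polynomial_identities (K : Type) [Field K] [IsAlgClosed K]
    (hchar : ringChar K ≠ 2) (α1 α2 : K) (n : ℕ) (p : FreeAlgebra K (Fin n))
    (hp : ∀ f : FreeAlgebra K (Fin n) →ₐ[K]
        (Matrix (Fin 2) (Fin 2) K × Matrix (Fin 2) (Fin 2) K × Matrix (Fin 2) (Fin 2) K),
      f p = 0) :
    ∀ g : FreeAlgebra K (Fin n) →ₐ[K] D3 K α1 α2, g p = 0 := by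
  intro g
  have : Infinite K := IsAlgClosed.instInfinite
  obtain ⟨δ, hδ⟩ := IsAlgClosed.exists_pow_nat_eq (3 * α1 - α2) two_pos
  choose y hy using fun i => RingQuot.mkAlgHom_surjective K (D3Rel K α1 α2) (g (ι K i))
  have hg : g = (RingQuot.mkAlgHom K (D3Rel K α1 α2)).comp (lift K y) := by
    refine FreeAlgebra.hom_ext (funext fun i => ?_)
    simp [hy]
  rw [hg, AlgHom.comp_apply]
  exact mkAlgHom_eq_zero hδ fun f => map_eq_zero_of_identity hp (f.comp (lift K y))
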